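/- Let (Ω,T) be a minimal subshift over a finite alphabet that satisfies Boshernitzan's condition (B), and let A : Ω → SL(2,ℝ) be locally constant. Then A is uniform, i.e., the limit Λ(A) = lim_{n→∞} (1/n) log‖A(n,ω)‖ exists for every ω ∈ Ω and the convergence is uniform on Ω. -/

import Mathlib

open Filter MeasureTheory Set

noncomputable section

/-- `SL(2,ℝ)`. -/
abbrev SL2 : Type := Matrix.SpecialLinearGroup (Fin 2) ℝ

/-- The left shift on two-sided sequences. -/
def shift (𝒜 : Type*) : (ℤ → 𝒜) → ℤ → 𝒜 := fun ω n => ω (n + 1)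

/-- A subshift: a closed, shift-invariant set of two-sided sequences. -/
def IsSubshift {𝒜 : Type*} [TopologicalSpace 𝒜] (Ω : Set (ℤ → 𝒜)) : Prop :=
  IsClosed Ω ∧ shift 𝒜 '' Ω = Ω

/-- A minimal subshift: every two-sided orbit is dense. -/
def IsMinimalSubshift {𝒜 : Type*} [TopologicalSpace 𝒜] (Ω : Set (ℤ → 𝒜)) : Prop :=
  IsSubshift Ω ∧ ∀ ω ∈ Ω, Ω ⊆ closure (Set.range fun k : ℤ => fun n : ℤ => ω (n + k))

/-- An aperiodic subshift: no nontrivial shift fixes a point of `Ω`. -/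
def IsAperiodicSubshift {𝒜 : Type*} (Ω : Set (ℤ → 𝒜)) : Prop :=
  ∀ ω ∈ Ω, ∀ n : ℤ, n ≠ 0 → (fun m => ω (m + n)) ≠ ω

/-- The word `w` occurs in `ω` starting at position `k`. -/
def OccursAt {𝒜 : Type*} (ω : ℤ → 𝒜) (w : List 𝒜) (k : ℤ) : Prop :=
  ∀ i : Fin w.length, ω (k + i) = w.get i

/-- `w` belongs to `𝒲(Ω)`, the set of finite words of the subshift `Ω`. -/
def IsWordOf {𝒜 : Type*} (Ω : Set (ℤ → 𝒜)) (w : List 𝒜) : Prop :=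
  ∃ ω ∈ Ω, ∃ k : ℤ, OccursAt ω w k

/-- `V_w = {ω ∈ Ω : ω(1)⋯ω(|w|) = w}`. -/
def Vset {𝒜 : Type*} (Ω : Set (ℤ → 𝒜)) (w : List 𝒜) : Set (ℤ → 𝒜) :=
  {ω ∈ Ω | OccursAt ω w 1}

/-- `U_w = {ω ∈ Ω : w occurs in ω around position one}`. -/
def Uset {𝒜 : Type*} (Ω : Set (ℤ → 𝒜)) (w : List 𝒜) : Set (ℤ → 𝒜) :=
  {ω ∈ Ω | ∃ n : ℕ, n < w.length ∧ OccursAt ω w (1 - n)}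

/-- Boshernitzan's condition (B): there are an ergodic probability measure `ν` (concentrated
on `Ω`), a constant `C > 0` and lengths `l n → ∞` with `|w| ν(V_w) ≥ C` whenever `|w| = l n`;
equivalently `limsup n η_ν(n) > 0`. -/
def CondB {𝒜 : Type*} [MeasurableSpace 𝒜] (Ω : Set (ℤ → 𝒜)) : Prop :=
  ∃ ν : Measure (ℤ → 𝒜), IsProbabilityMeasure ν ∧ ν Ωᶜ = 0 ∧ Ergodic (shift 𝒜) ν ∧
    ∃ C > (0 : ℝ), ∃ l : ℕ → ℕ, Tendsto l atTop atTop ∧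
      ∀ n : ℕ, ∀ w : List 𝒜, IsWordOf Ω w → w.length = l n →
        C ≤ (w.length : ℝ) * (ν (Vset Ω w)).toReal

/-- Condition (B'): there are an ergodic probability measure `ν` (concentrated on `Ω`),
a constant `C' > 0` and lengths `l n → ∞` with `ν(U_w) ≥ C'` whenever `|w| = l n`. -/
def CondB' {𝒜 : Type*} [MeasurableSpace 𝒜] (Ω : Set (ℤ → 𝒜)) : Prop :=
  ∃ ν : Measure (ℤ → 𝒜), IsProbabilityMeasure ν ∧ ν Ωᶜ = 0 ∧ Ergodic (shift 𝒜) ν ∧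
    ∃ C > (0 : ℝ), ∃ l : ℕ → ℕ, Tendsto l atTop atTop ∧
      ∀ n : ℕ, ∀ w : List 𝒜, IsWordOf Ω w → w.length = l n →
        C ≤ (ν (Uset Ω w)).toReal

/-- Unique ergodicity: there is exactly one shift-invariant Borel probability measure
concentrated on `Ω`. -/
def UniquelyErgodicSubshift {𝒜 : Type*} [MeasurableSpace 𝒜] (Ω : Set (ℤ → 𝒜)) : Prop :=
  ∃! ν : Measure (ℤ → 𝒜),
    IsProbabilityMeasure ν ∧ ν Ωᶜ = 0 ∧ MeasurePreserving (shift 𝒜) ν ν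

/-- A function on sequences is locally constant (on `Ω`) if its value only depends on
the coordinates `ω(−N)⋯ω(N)` for some `N`. -/
def LocConstOn {𝒜 β : Type*} (Ω : Set (ℤ → 𝒜)) (A : (ℤ → 𝒜) → β) : Prop :=
  ∃ N : ℕ, ∀ ω ∈ Ω, ∀ ρ ∈ Ω, (∀ i : ℤ, |i| ≤ (N : ℤ) → ω i = ρ i) → A ω = A ρ

/-- The cocycle `A(n,ω) = A(T^{n−1}ω)⋯A(ω)`. -/
def cocycle {𝒜 G : Type*} [Monoid G] (A : (ℤ → 𝒜) → G) : ℕ → (ℤ → 𝒜) → G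
  | 0, _ => 1
  | n + 1, ω => A ((shift 𝒜)^[n] ω) * cocycle A n ω

/-- A concrete norm on 2×2 real matrices (the Frobenius norm). -/
def matNorm (M : Matrix (Fin 2) (Fin 2) ℝ) : ℝ :=
  Real.sqrt (∑ i : Fin 2, ∑ j : Fin 2, (M i j) ^ 2)

/-- `A : Ω → SL(2,ℝ)` is uniform: `(1/n) log‖A(n,ω)‖` converges, uniformly on `Ω`,
to a constant `Λ(A)`. -/
def IsUniformOn {𝒜 : Type*} (Ω : Set (ℤ → 𝒜)) (A : (ℤ → 𝒜) → SL2) : Prop :=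
  ∃ Λ : ℝ, TendstoUniformlyOn
    (fun (n : ℕ) (ω : ℤ → 𝒜) =>
      (n : ℝ)⁻¹ * Real.log (matNorm ((cocycle A n ω : SL2) : Matrix (Fin 2) (Fin 2) ℝ)))
    (fun _ => Λ) atTop Ω

/-- Property (P): every locally constant `SL(2,ℝ)`-valued function on `Ω` is uniform. -/
def PropP {𝒜 : Type*} (Ω : Set (ℤ → 𝒜)) : Prop :=
  ∀ A : (ℤ → 𝒜) → SL2, LocConstOn Ω A → IsUniformOn Ω A

/-- The word `ω(1)⋯ω(n)`. -/
def wordOf {𝒜 : Type*} (ω : ℤ → 𝒜) (n : ℕ) : List 𝒜 :=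
  (List.range n).map fun i => ω (1 + i)

/-- A subadditive function on the words of `Ω`. -/
def SubadditiveOn {𝒜 : Type*} (Ω : Set (ℤ → 𝒜)) (F : List 𝒜 → ℝ) : Prop :=
  ∀ x y : List 𝒜, IsWordOf Ω x → IsWordOf Ω y → IsWordOf Ω (x ++ y) →
    F (x ++ y) ≤ F x + F y

/-- The complexity function `p(n) = #{w ∈ 𝒲(Ω) : |w| = n}`. -/
def complexity {𝒜 : Type*} (Ω : Set (ℤ → 𝒜)) (n : ℕ) : ℕ :=
  Set.ncard {w : List 𝒜 | IsWordOf Ω w ∧ w.length = n}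

/-- A right-special word. -/
def RightSpecial {𝒜 : Type*} (Ω : Set (ℤ → 𝒜)) (w : List 𝒜) : Prop :=
  ∃ a b : 𝒜, a ≠ b ∧ IsWordOf Ω (w ++ [a]) ∧ IsWordOf Ω (w ++ [b])

/-- A left-special word. -/
def LeftSpecial {𝒜 : Type*} (Ω : Set (ℤ → 𝒜)) (w : List 𝒜) : Prop :=
  ∃ a b : 𝒜, a ≠ b ∧ IsWordOf Ω (a :: w) ∧ IsWordOf Ω (b :: w)

/-- `σ ∈ ℬ^ℤ` is the image of `ω ∈ 𝒜^ℤ` under the substitution `S`, with `S(ω(0))`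
starting at position `0`. -/
def IsSubstImage {𝒜 ℬ : Type*} (S : 𝒜 → List ℬ) (ω : ℤ → 𝒜) (σ : ℤ → ℬ) : Prop :=
  ∃ c : ℤ → ℤ, c 0 = 0 ∧ (∀ k : ℤ, c (k + 1) = c k + (S (ω k)).length) ∧
    ∀ k : ℤ, ∀ j : Fin (S (ω k)).length, σ (c k + j) = (S (ω k)).get j

/-- `Ω(S) = {T^k S(ω) : ω ∈ Ω, k ∈ ℤ}`. -/
def SubstSubshift {𝒜 ℬ : Type*} (S : 𝒜 → List ℬ) (Ω : Set (ℤ → 𝒜)) : Set (ℤ → ℬ) :=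
  {τ | ∃ ω ∈ Ω, ∃ σ : ℤ → ℬ, IsSubstImage S ω σ ∧ ∃ k : ℤ, τ = fun n => σ (n + k)}

/-- `S` is recognizable with respect to `(Ω,T)`: there is a locally constant
`S̃ : Ω(S) → Ω × ℤ` with `S̃(T^k S(ω)) = (ω,k)` for `0 ≤ k ≤ |S(ω(0))|`. -/
def Recognizable {𝒜 ℬ : Type*} (S : 𝒜 → List ℬ) (Ω : Set (ℤ → 𝒜)) : Prop :=
  ∃ St : (ℤ → ℬ) → (ℤ → 𝒜) × ℤ, LocConstOn (SubstSubshift S Ω) St ∧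
    ∀ ω ∈ Ω, ∀ σ : ℤ → ℬ, IsSubstImage S ω σ →
      ∀ k : ℕ, k ≤ (S (ω 0)).length → St (fun n => σ (n + k)) = (ω, (k : ℤ))

/-- A Cantor set: compact, empty interior, no isolated points. -/
def IsCantorSet (S : Set ℝ) : Prop :=
  IsCompact S ∧ interior S = ∅ ∧ ∀ x ∈ S, AccPt x (Filter.principal S)

/-- `H` is the Schrödinger operator on `ℓ²(ℤ)` with potential `V`:
`(Hu)(n) = u(n+1) + u(n−1) + V(n)u(n)`. -/
def IsSchrodingerOp (V : ℤ → ℝ)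
    (H : lp (fun _ : ℤ => ℝ) 2 →L[ℝ] lp (fun _ : ℤ => ℝ) 2) : Prop :=
  ∀ u : lp (fun _ : ℤ => ℝ) 2, ∀ n : ℤ,
    (H u : ∀ _ : ℤ, ℝ) n = (u : ∀ _ : ℤ, ℝ) (n + 1) + (u : ∀ _ : ℤ, ℝ) (n - 1)
      + V n * (u : ∀ _ : ℤ, ℝ) n

/-- The circle map potential `V_{α,β,θ}(n) = χ_{[1−β,1)}(nα + θ mod 1)`. -/
def circleV (α β θ : ℝ) : ℤ → ℝ := fun n =>
  (Set.Ico (1 - β) 1).indicator (fun _ => (1 : ℝ)) (Int.fract (n * α + θ))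

/-- The coding `v_n(α,β,θ) = χ_{[0,β)}(nα + θ mod 1)` of the rotation by `α`. -/
def circleSeq (α β θ : ℝ) : ℤ → Bool := fun n =>
  if Int.fract (n * α + θ) < β then true else false

/-- The circle map subshift `Ω_{α,β}`. -/
def circleSubshift (α β : ℝ) : Set (ℤ → Bool) :=
  closure {ω | ∃ θ : ℝ, 0 ≤ θ ∧ θ < 1 ∧ ω = circleSeq α β θ}

/-- The one-step transfer matrix `M^E(ω)`. -/
def transferMat (E : ℝ) (ω : ℤ → ℝ) : Matrix (Fin 2) (Fin 2) ℝ :=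
  !![E - ω 1, -1; 1, 0]

/-- The Lyapunov exponent `γ(E) = inf_{n ≥ 1} (1/n) ∫ log‖M^E(n,ω)‖ dμ(ω)`. -/
def lyapunov (μ : Measure (ℤ → ℝ)) (E : ℝ) : ℝ :=
  ⨅ n : ℕ+, ((n : ℕ) : ℝ)⁻¹ *
    ∫ ω, Real.log (matNorm (cocycle (transferMat E) (n : ℕ) ω)) ∂μ

end

open Topology

/-- Mean ergodic theorem for sets, in the form of convergence in measure. -/
theorem Ergodic.tendsto_measure_abs_average_sub_ge {α : Type*} [MeasurableSpace α] {μ : Measure α}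
    [IsProbabilityMeasure μ] {T : α → α} (hT : Ergodic T μ) {V : Set α} (hV : MeasurableSet V)
    {ε : ℝ} (hε : 0 < ε) :
    Tendsto (fun n : ℕ => μ {x | ε ≤ |(n : ℝ)⁻¹ * ∑ i ∈ Finset.range n,
      V.indicator (fun _ => (1 : ℝ)) (T^[i] x) - μ.real V|}) atTop (𝓝 0) := by
  have hTm : MeasurePreserving T μ μ := hT.toMeasurePreserving
  let U : Lp ℝ 2 μ →ₗᵢ[ℝ] Lp ℝ 2 μ := Lp.compMeasurePreservingₗᵢ ℝ T hTm
  let x : Lp ℝ 2 μ := indicatorConstLp 2 hV (measure_ne_top μ V) (1 : ℝ)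
  let one : Lp ℝ 2 μ := indicatorConstLp 2 MeasurableSet.univ (measure_ne_top μ univ) (1 : ℝ)
  have hU1 : U.toContinuousLinearMap one = one := by
    change Lp.compMeasurePreserving T hTm one = one
    simp only [one]
    rw [Lp.indicatorConstLp_compMeasurePreserving]
    rfl
  have hlim := U.toContinuousLinearMap.tendsto_birkhoffAverage_orthogonalProjection
    U.norm_toContinuousLinearMap_le x
  set S := U.toContinuousLinearMap.eqLocus (1 : Lp ℝ 2 μ →L[ℝ] Lp ℝ 2 μ) with hS
  set y : Lp ℝ 2 μ := (S.orthogonalProjectionOnto x : Lp ℝ 2 μ) with hy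
  have hyfix : Lp.compMeasurePreserving T hTm y = y := (S.orthogonalProjectionOnto x).2
  obtain ⟨c, hc⟩ := hT.ae_eq_const_of_ae_eq_comp_ae (Lp.aestronglyMeasurable y)
    ((Lp.coeFn_compMeasurePreserving y hTm).symm.trans (by rw [hyfix]))
  have hinner (z : Lp ℝ 2 μ) : inner ℝ one z = ∫ a, z a ∂μ := by
    simp only [one]
    rw [MeasureTheory.L2.inner_indicatorConstLp_one]
    simp
  have hcV : c = μ.real V := by
    have h1 : inner ℝ one y = inner ℝ one x := by
      have : inner ℝ (⟨one, hU1⟩ : S) (S.orthogonalProjectionOnto x)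
          = inner ℝ ((⟨one, hU1⟩ : S) : Lp ℝ 2 μ) x := by
        exact Submodule.inner_orthogonalProjectionOnto_eq_of_mem_left (K := S) ⟨one, hU1⟩ x
      exact this
    rw [hinner, hinner, integral_congr_ae hc, integral_congr_ae indicatorConstLp_coeFn] at h1
    simpa [integral_indicator hV] using h1
  have hmeas := tendstoInMeasure_of_tendsto_Lp hlim
  rw [tendstoInMeasure_iff_dist] at hmeas
  refine (hmeas ε hε).congr fun n => measure_congr ?_
  have hiter (i : ℕ) : ((U.toContinuousLinearMap^[i] x : Lp ℝ 2 μ) : α → ℝ) =ᵐ[μ]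
      fun a => V.indicator (fun _ => (1 : ℝ)) (T^[i] a) := by
    have : U.toContinuousLinearMap^[i] x = Lp.compMeasurePreserving (T^[i]) (hTm.iterate i) x := by
      rw [← Lp.compMeasurePreserving_iterate]
      rfl
    rw [this]
    refine (Lp.coeFn_compMeasurePreserving x (hTm.iterate i)).trans ?_
    exact (hTm.iterate i).quasiMeasurePreserving.ae_eq_comp indicatorConstLp_coeFn
  have havg : ((birkhoffAverage ℝ U.toContinuousLinearMap _root_.id n x : Lp ℝ 2 μ) : α → ℝ)
      =ᵐ[μ] fun a => (n : ℝ)⁻¹ * ∑ i ∈ Finset.range n,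
        V.indicator (fun _ => (1 : ℝ)) (T^[i] a) := by
    rw [birkhoffAverage, birkhoffSum]
    refine (Lp.coeFn_smul _ _).trans ?_
    have hsum (k : ℕ) : ((∑ i ∈ Finset.range k, U.toContinuousLinearMap^[i] x : Lp ℝ 2 μ) : α → ℝ)
        =ᵐ[μ] fun a => ∑ i ∈ Finset.range k, V.indicator (fun _ => (1 : ℝ)) (T^[i] a) := by
      induction k with
      | zero =>
        simp only [Finset.range_zero, Finset.sum_empty]
        exact Lp.coeFn_zero _ _ _
      | succ k ih =>
        simp only [Finset.sum_range_succ]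
        exact (Lp.coeFn_add _ _).trans (ih.add (hiter k))
    filter_upwards [hsum n] with a ha
    simp only [Pi.smul_apply, smul_eq_mul, id]
    rw [ha]
  filter_upwards [havg, hc] with a ha hb
  apply propext
  change ε ≤ dist _ _ ↔ ε ≤ |_|
  rw [ha, hb, Real.dist_eq, ← hcV]
  rfl

section Words

variable {𝒜 : Type*}

theorem shift_iterate_apply (n : ℕ) (ω : ℤ → 𝒜) (i : ℤ) : (shift 𝒜)^[n] ω i = ω (i + n) := by
  induction n generalizing ω i with
  | zero => simp
  | succ n ih =>
    rw [Function.iterate_succ_apply, ih]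
    simp only [shift]
    congr 1
    push_cast
    ring

/-- Sequences agreeing with `σ` on the positions `1, …, M`. -/
def agreeSet (σ : ℤ → 𝒜) (M : ℕ) : Set (ℤ → 𝒜) :=
  {ρ | ∀ i : ℤ, 1 ≤ i → i ≤ M → ρ i = σ i}

theorem agreeSet_anti (σ : ℤ → 𝒜) {M M' : ℕ} (h : M ≤ M') : agreeSet σ M' ⊆ agreeSet σ M :=
  fun _ hρ i h1 h2 => hρ i h1 (h2.trans (by exact_mod_cast h))

theorem IsSubshift.iterate_mem [TopologicalSpace 𝒜] {Ω : Set (ℤ → 𝒜)} (h : IsSubshift Ω)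
    {ω : ℤ → 𝒜} (hω : ω ∈ Ω) (n : ℕ) : (shift 𝒜)^[n] ω ∈ Ω := by
  induction n with
  | zero => exact hω
  | succ n ih =>
    rw [Function.iterate_succ_apply', ← h.2]
    exact mem_image_of_mem _ ih

theorem IsSubshift.exists_iterate_eq [TopologicalSpace 𝒜] {Ω : Set (ℤ → 𝒜)} (h : IsSubshift Ω)
    {ω : ℤ → 𝒜} (hω : ω ∈ Ω) (n : ℕ) : ∃ ρ ∈ Ω, (shift 𝒜)^[n] ρ = ω := by
  induction n with
  | zero => exact ⟨ω, hω, rfl⟩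
  | succ n ih =>
    obtain ⟨ρ, hρ, rfl⟩ := ih
    rw [← h.2] at hρ
    obtain ⟨τ, hτ, rfl⟩ := hρ
    exact ⟨τ, hτ, Function.iterate_succ_apply _ _ _⟩

/-- A sequence with a self-overlapping prefix of length `2 * m` whose period breaks later can be
moved so that the break happens just after the prefix. -/
theorem exists_period_break [TopologicalSpace 𝒜] {Ω : Set (ℤ → 𝒜)} (h : IsSubshift Ω)
    (ω : ℤ → 𝒜) (m r : ℕ) (hr : 1 ≤ r) (hrm : r ≤ m) (q : ℕ) :
    ∀ ρ ∈ Ω, ρ ∈ agreeSet ω (2 * m) → 2 * m < q + r →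
      (∀ i : ℤ, 1 ≤ i → i < q → ρ (i + r) = ρ i) → ρ (q + r) ≠ ρ q →
      ∃ τ ∈ Ω, τ ∈ agreeSet ω (2 * m) ∧ ∃ b : ℕ, b ≤ 2 * m ∧ 2 * m < b + r ∧
        (∀ i : ℤ, 1 ≤ i → i < b → τ (i + r) = τ i) ∧ τ (b + r) ≠ τ b := by
  induction q using Nat.strong_induction_on with
  | _ q ih =>
    intro ρ hρ hag hlt hper hbr
    by_cases hq : q ≤ 2 * m
    · exact ⟨ρ, hρ, hag, q, hq, hlt, hper, hbr⟩
    · obtain ⟨q', rfl⟩ := Nat.exists_eq_add_of_le' (show r ≤ q by omega)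
      refine ih q' (by omega) ((shift 𝒜)^[r] ρ) (h.iterate_mem hρ r) ?_ (by omega) ?_ ?_
      · intro i h1 h2
        rw [shift_iterate_apply, ← hag i h1 h2]
        exact hper i h1 (by push_cast at *; omega)
      · intro i h1 h2
        rw [shift_iterate_apply, shift_iterate_apply]
        exact hper _ (by omega) (by push_cast; omega)
      · rw [shift_iterate_apply, shift_iterate_apply]
        push_cast at hbr
        exact hbr

/-- In an aperiodic subshift every prefix extends to a word whose occurrences are far apart. -/
theorem exists_separated_extension [TopologicalSpace 𝒜] {Ω : Set (ℤ → 𝒜)} (h : IsSubshift Ω)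
    (hap : ∀ ρ ∈ Ω, ∀ r : ℕ, 1 ≤ r → ∃ q : ℕ, 1 ≤ q ∧ ρ (q + r) ≠ ρ q)
    {ω : ℤ → 𝒜} (hω : ω ∈ Ω) (m : ℕ) :
    ∃ τ ∈ Ω, τ ∈ agreeSet ω (2 * m) ∧ ∀ ρ ∈ Ω, ∀ s : ℕ, 1 ≤ s → s < m →
      ρ ∈ agreeSet τ (4 * m) → (shift 𝒜)^[s] ρ ∉ agreeSet τ (4 * m) := by
  by_cases hov : ∃ ρ ∈ Ω, ∃ r : ℕ, 1 ≤ r ∧ r < m ∧ ρ ∈ agreeSet ω (2 * m) ∧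
      (shift 𝒜)^[r] ρ ∈ agreeSet ω (2 * m)
  · obtain ⟨ρ, hρ, r, hr1, hrm, hag, hag'⟩ := hov
    have hper : ∀ i : ℤ, 1 ≤ i → i ≤ 2 * m → ρ (i + r) = ρ i := by
      intro i h1 h2
      rw [hag i h1 (by push_cast; omega), ← hag' i h1 (by push_cast; omega), shift_iterate_apply]
    classical
    obtain ⟨hq1, hqne⟩ := Nat.find_spec (hap ρ hρ r hr1)
    set q := Nat.find (hap ρ hρ r hr1) with hq
    have hmin : ∀ i : ℤ, 1 ≤ i → i < q → ρ (i + r) = ρ i := by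
      intro i h1 h2
      obtain ⟨k, rfl⟩ := Int.eq_ofNat_of_zero_le (show 0 ≤ i by omega)
      have := Nat.find_min (hap ρ hρ r hr1) (m := k) (by omega)
      by_contra hne
      exact this ⟨by omega, hne⟩
    have hq2 : 2 * m < q + r := by
      by_contra hcon
      exact hqne (hper q (by omega) (by omega))
    obtain ⟨τ, hτ, hτag, b, hb1, hb2, hτper, hτbr⟩ :=
      exists_period_break h ω m r hr1 hrm.le q ρ hρ hag hq2 hmin hqne
    refine ⟨τ, hτ, hτag, fun x _ s hs1 hsm hx hx' => hτbr ?_⟩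
    have e1 := hx b (by omega) (by push_cast; omega)
    have e2 := hx (b + r) (by omega) (by push_cast; omega)
    have e3 := hx' (b - s) (by omega) (by push_cast; omega)
    have e4 := hx' (b - s + r) (by omega) (by push_cast; omega)
    rw [shift_iterate_apply] at e3 e4
    have e5 := hτper (b - s) (by omega) (by omega)
    rw [← e1, ← e2, show (b : ℤ) + r = b - s + r + s by ring, e4, e5, ← e3]
    congr 1
    ring
  · push Not at hov
    refine ⟨ω, hω, fun _ _ _ => rfl, fun ρ hρ s hs1 hsm hx hx' => ?_⟩
    exact hov ρ hρ s hs1 hsm (agreeSet_anti ω (by omega) hx) (agreeSet_anti ω (by omega) hx')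

/-- A minimal subshift containing a point that is periodic to the right is periodic. -/
theorem IsMinimalSubshift.periodic_of_eventually [TopologicalSpace 𝒜] [DiscreteTopology 𝒜]
    {Ω : Set (ℤ → 𝒜)} (h : IsMinimalSubshift Ω) {ρ : ℤ → 𝒜} (hρ : ρ ∈ Ω) {r : ℕ} (hr : 1 ≤ r)
    (hper : ∀ q : ℕ, 1 ≤ q → ρ (q + r) = ρ q) :
    ∃ τ ∈ Ω, (∀ i, τ (i + r) = τ i) ∧
      ∀ ω ∈ Ω, ∃ k : ℕ, k < r ∧ (shift 𝒜)^[k] ω = τ := by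
  have hr0 : (0 : ℤ) < r := by exact_mod_cast hr
  let τ : ℤ → 𝒜 := fun i => ρ (1 + i % r)
  have hper' (k : ℕ) : ∀ i : ℤ, 1 ≤ i → ρ (i + k * r) = ρ i := by
    induction k with
    | zero => simp
    | succ k ih =>
      intro i hi
      rw [← ih i hi]
      obtain ⟨j, hj⟩ := Int.eq_ofNat_of_zero_le (show 0 ≤ i + k * r by positivity)
      have := hper j (by zify; rw [← hj]; nlinarith)
      rw [← hj] at this
      rw [← this]
      congr 1
      push_cast
      ring
  have hτper : ∀ i, τ (i + r) = τ i := fun i => by simp [τ]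
  have hlim : Tendsto (fun k : ℕ => (shift 𝒜)^[1 + k * r] ρ) atTop (𝓝 τ) := by
    rw [tendsto_pi_nhds]
    intro i
    refine tendsto_const_nhds.congr' ?_
    filter_upwards [eventually_ge_atTop i.natAbs] with k hk
    rw [shift_iterate_apply]
    have hk' : 0 ≤ k + i / r := by
      have : -(k : ℤ) ≤ i / r := by
        rw [Int.le_ediv_iff_mul_le hr0]
        nlinarith [abs_le.1 (show |i| ≤ k by rw [Int.abs_eq_natAbs]; exact_mod_cast hk)]
      omega
    obtain ⟨j, hj⟩ := Int.eq_ofNat_of_zero_le hk'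
    have := hper' j (1 + i % r) (by have := Int.emod_nonneg i hr0.ne'; omega)
    change ρ (1 + i % r) = _
    rw [← this, ← hj]
    congr 1
    push_cast
    nlinarith [Int.emod_add_mul_ediv i r]
  have hτ : τ ∈ Ω := h.1.1.mem_of_tendsto hlim (.of_forall fun k => h.1.iterate_mem hρ _)
  refine ⟨τ, hτ, hτper, ?_⟩
  have hmod (i k : ℤ) : τ (i + k * r) = τ i := by simp [τ]
  let F : Set (ℤ → 𝒜) := (fun k : ℕ => fun n : ℤ => τ (n + k)) '' (Finset.range r)
  have hF : IsClosed F := ((Finset.range r).finite_toSet.image _).isClosed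
  intro ω hω
  have hsub : Ω ⊆ F := by
    refine (h.2 τ hτ).trans (closure_minimal ?_ hF)
    rintro _ ⟨k, rfl⟩
    refine ⟨(k % r).toNat, ?_, ?_⟩
    · have := Int.emod_lt_of_pos k hr0
      have := Int.emod_nonneg k hr0.ne'
      simp only [Finset.coe_range, mem_Iio]
      omega
    · funext n
      have := hmod (n + k % r) (k / r)
      change τ (n + ((k % r).toNat : ℤ)) = τ (n + k)
      rw [Int.toNat_of_nonneg (Int.emod_nonneg k hr0.ne'), ← this]
      congr 1
      nlinarith [Int.emod_add_mul_ediv k r]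
  obtain ⟨k, hk, rfl⟩ := hsub hω
  simp only [Finset.coe_range, mem_Iio] at hk
  refine ⟨(r - k) % r, Nat.mod_lt _ hr, ?_⟩
  funext n
  rw [shift_iterate_apply]
  rcases Nat.eq_zero_or_pos k with rfl | hk0
  · simp
  · rw [Nat.mod_eq_of_lt (by omega), ← hτper n]
    change τ (n + ((r - k : ℕ) : ℤ) + (k : ℤ)) = _
    congr 1
    push_cast [hk.le]
    ring

end Words

section Frequency

variable {𝒜 : Type*}

/-- Letters of a minimal subshift of full outer measure are measurable, whatever the
`σ`-algebra on the alphabet. -/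
theorem IsMinimalSubshift.measurableSet_letter [Finite 𝒜] [TopologicalSpace 𝒜]
    [DiscreteTopology 𝒜] [MeasurableSpace 𝒜] {Ω : Set (ℤ → 𝒜)} (h : IsMinimalSubshift Ω)
    {ν : Measure (ℤ → 𝒜)} [IsProbabilityMeasure ν] (hν : ν Ωᶜ = 0) {σ : ℤ → 𝒜} (hσ : σ ∈ Ω)
    (i : ℤ) : MeasurableSet {σ i} := by
  classical
  by_cases hat : measurableAtom (σ i) = {σ i}
  · rw [← hat]
    exact MeasurableSet.measurableAtom_of_countable _
  exfalso
  obtain ⟨b, hb, hbne⟩ : ∃ b ∈ measurableAtom (σ i), b ≠ σ i := by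
    by_contra hcon
    push Not at hcon
    exact hat (Subset.antisymm hcon (by simp))
  let f : 𝒜 → 𝒜 := fun x => if x = σ i then b else x
  have hb' {s : Set 𝒜} (hs : MeasurableSet s) : b ∈ s ↔ σ i ∈ s := by
    constructor
    · intro hbs
      by_contra hns
      exact mem_of_mem_measurableAtom hb hs.compl hns hbs
    · exact mem_of_mem_measurableAtom hb hs
  have hinv (N : Set (ℤ → 𝒜)) (hN : MeasurableSet N) (x : ℤ → 𝒜) :
      (f ∘ x) ∈ N ↔ x ∈ N := by
    let m : MeasurableSpace (ℤ → 𝒜) :=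
      { MeasurableSet' := fun N => ∀ x, (f ∘ x) ∈ N ↔ x ∈ N
        measurableSet_empty := fun _ => Iff.rfl
        measurableSet_compl := fun _ hs x => not_congr (hs x)
        measurableSet_iUnion := fun _ hs x => by simp only [mem_iUnion, hs _ x] }
    have hle : MeasurableSpace.pi ≤ m := by
      refine iSup_le fun j => ?_
      rintro _ ⟨s, hs, rfl⟩
      intro x
      simp only [mem_preimage, Function.comp, f]
      split_ifs with hx
      · rw [hx]
        exact hb' hs
      · rfl
    exact hle N hN x
  obtain ⟨x, hx⟩ : (toMeasurable ν Ωᶜ)ᶜ.Nonempty := by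
    rw [nonempty_iff_ne_empty, ne_eq, compl_empty_iff]
    intro huniv
    have := measure_toMeasurable (μ := ν) Ωᶜ
    rw [huniv, hν, measure_univ] at this
    exact one_ne_zero this
  have hfx : f ∘ x ∈ Ω := by
    by_contra hcon
    exact hx ((hinv _ (measurableSet_toMeasurable _ _) x).1 (subset_toMeasurable ν Ωᶜ hcon))
  have hcont : Continuous fun y : ℤ → 𝒜 => y i := continuous_apply i
  have hopen : IsOpen {y : ℤ → 𝒜 | y i = σ i} := hcont.isOpen_preimage _ (isOpen_discrete {σ i})
  obtain ⟨_, hy, k, rfl⟩ := mem_closure_iff.1 (h.2 _ hfx hσ) _ hopen rfl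
  simp only [mem_ofPred_eq, Function.comp, f] at hy
  split_ifs at hy with hk
  · exact hbne hy
  · exact hk hy

theorem measurableSet_agreeSet [MeasurableSpace 𝒜] {σ : ℤ → 𝒜}
    (hσ : ∀ i, MeasurableSet {σ i}) (M : ℕ) : MeasurableSet (agreeSet σ M) := by
  have : agreeSet σ M = ⋂ i ∈ Set.Icc (1 : ℤ) M, (fun ρ : ℤ → 𝒜 => ρ i) ⁻¹' {σ i} := by
    ext ρ
    simp [agreeSet]
  rw [this]
  exact MeasurableSet.biInter (Set.to_countable _) fun i _ => measurable_pi_apply i (hσ i)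

theorem Vset_ofFn_subset (Ω : Set (ℤ → 𝒜)) (σ : ℤ → 𝒜) (M : ℕ) :
    Vset Ω (List.ofFn fun i : Fin M => σ (1 + i)) ⊆ agreeSet σ M := by
  rintro ρ ⟨-, hρ⟩ i h1 h2
  have := hρ ⟨(i - 1).toNat, by rw [List.length_ofFn]; omega⟩
  rw [List.get_ofFn] at this
  simp only [Fin.val_cast] at this
  rwa [Int.toNat_of_nonneg (by omega), add_sub_cancel] at this

theorem isWordOf_ofFn {Ω : Set (ℤ → 𝒜)} {σ : ℤ → 𝒜} (hσ : σ ∈ Ω) (M : ℕ) :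
    IsWordOf Ω (List.ofFn fun i : Fin M => σ (1 + i)) :=
  ⟨σ, hσ, 1, fun i => by rw [List.get_ofFn]; simp⟩

open Classical in
/-- The number of visits of the orbit `ω, Tω, …, T^{n-1}ω` to `V`. -/
noncomputable def visits (V : Set (ℤ → 𝒜)) (n : ℕ) (ω : ℤ → 𝒜) : ℕ :=
  ∑ i ∈ Finset.range n, if (shift 𝒜)^[i] ω ∈ V then 1 else 0

theorem visits_add (V : Set (ℤ → 𝒜)) (a b : ℕ) (ω : ℤ → 𝒜) :
    visits V (a + b) ω = visits V a ω + visits V b ((shift 𝒜)^[a] ω) := by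
  simp only [visits, Finset.sum_range_add]
  congr 1
  refine Finset.sum_congr rfl fun i _ => ?_
  rw [← Function.iterate_add_apply, add_comm i a]

theorem visits_mono (V : Set (ℤ → 𝒜)) {a b : ℕ} (h : a ≤ b) (ω : ℤ → 𝒜) :
    visits V a ω ≤ visits V b ω := by
  obtain ⟨c, rfl⟩ := Nat.exists_eq_add_of_le h
  rw [visits_add]
  exact Nat.le_add_right _ _

theorem visits_congr {V : Set (ℤ → 𝒜)} {n : ℕ} {ω ρ : ℤ → 𝒜}
    (h : ∀ i < n, (shift 𝒜)^[i] ω ∈ V ↔ (shift 𝒜)^[i] ρ ∈ V) : visits V n ω = visits V n ρ := by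
  unfold visits
  refine Finset.sum_congr rfl fun i hi => ?_
  by_cases hx : (shift 𝒜)^[i] ω ∈ V
  · rw [if_pos hx, if_pos ((h i (Finset.mem_range.1 hi)).1 hx)]
  · rw [if_neg hx, if_neg fun hy => hx ((h i (Finset.mem_range.1 hi)).2 hy)]

theorem visits_eq_zero {V : Set (ℤ → 𝒜)} {n : ℕ} {ω : ℤ → 𝒜}
    (h : ∀ i < n, (shift 𝒜)^[i] ω ∉ V) : visits V n ω = 0 :=
  Finset.sum_eq_zero fun i hi => if_neg (h i (Finset.mem_range.1 hi))

theorem cast_visits (V : Set (ℤ → 𝒜)) (n : ℕ) (ω : ℤ → 𝒜) :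
    (visits V n ω : ℝ) =
      ∑ i ∈ Finset.range n, V.indicator (fun _ => (1 : ℝ)) ((shift 𝒜)^[i] ω) := by
  classical
  simp [visits, indicator_apply]

theorem iterate_mem_agreeSet_congr {σ x ω : ℤ → 𝒜} {M K a : ℕ} (h : x ∈ agreeSet ω K)
    (ha : a + M ≤ K) : (shift 𝒜)^[a] x ∈ agreeSet σ M ↔ (shift 𝒜)^[a] ω ∈ agreeSet σ M := by
  refine forall_congr' fun i => forall_congr' fun h1 => forall_congr' fun h2 => ?_
  rw [shift_iterate_apply, shift_iterate_apply, h (i + a) (by omega) (by zify at ha; omega)]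

/-- Under Boshernitzan's condition, words of the distinguished lengths occur in all long words with
a frequency bounded below by a multiple of the inverse of their length. -/
theorem exists_visits_ge [TopologicalSpace 𝒜] [MeasurableSpace 𝒜]
    {Ω : Set (ℤ → 𝒜)} (hΩ : IsSubshift Ω)
    (hap : ∀ ρ ∈ Ω, ∀ r : ℕ, 1 ≤ r → ∃ q : ℕ, 1 ≤ q ∧ ρ (q + r) ≠ ρ q)
    {ν : Measure (ℤ → 𝒜)} [IsProbabilityMeasure ν] (hν : ν Ωᶜ = 0) (herg : Ergodic (shift 𝒜) ν)
    {C : ℝ} (hC : 0 < C) {l : ℕ → ℕ} (hl : Tendsto l atTop atTop)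
    (hfreq : ∀ n, ∀ σ ∈ Ω, C ≤ l n * ν.real (agreeSet σ (l n)))
    (hmeas : ∀ σ ∈ Ω, ∀ M, MeasurableSet (agreeSet σ M))
    {σ : ℤ → 𝒜} (hσ : σ ∈ Ω) (n : ℕ) :
    ∃ L₀ : ℕ, ∀ ω ∈ Ω, ∀ L ≥ L₀, C * L ≤ 8 * l n * visits (agreeSet σ (l n)) L ω := by
  set M := l n with hM
  set V := agreeSet σ M with hV
  set p := ν.real V with hp
  have hCp : C ≤ M * p := hfreq n σ hσ
  have hp0 : 0 < p := by
    have : 0 ≤ (M : ℝ) := Nat.cast_nonneg _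
    by_contra hcon
    nlinarith
  have hlim := herg.tendsto_measure_abs_average_sub_ge (hmeas σ hσ M) (half_pos hp0)
  have hev := hlim.eventually_lt_const (show (0 : ENNReal) < ENNReal.ofReal (C / 8) by positivity)
  obtain ⟨k₀, hk₀⟩ := eventually_atTop.1 hev
  obtain ⟨n', hn'⟩ := (hl.eventually_ge_atTop (8 * M + 8 * k₀ + 8)).exists
  set k := l n' / 4 with hk
  obtain ⟨k', hkk'⟩ := Nat.exists_eq_add_of_le' (show M ≤ k by omega)
  have hk'0 : 0 < k' := by omega
  have hk'R : (0 : ℝ) < k' := by exact_mod_cast hk'0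
  have key : ∀ ω ∈ Ω, p * k' ≤ 2 * visits V (2 * k') ω := by
    intro ω hω
    by_contra! hcon
    obtain ⟨τ, hτ, hτω, hsep⟩ := exists_separated_extension hΩ hap hω k
    let E : ℕ → Set (ℤ → 𝒜) := fun j => (shift 𝒜)^[j] ⁻¹' agreeSet τ (4 * k)
    let Bad : Set (ℤ → 𝒜) := {x | p / 2 ≤ |(k' : ℝ)⁻¹ * ∑ i ∈ Finset.range k',
      V.indicator (fun _ => (1 : ℝ)) ((shift 𝒜)^[i] x) - p|}
    have hBad : ν Bad < ENNReal.ofReal (C / 8) := hk₀ k' (by omega)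
    have hsubset : (⋃ j ∈ Finset.range k', E j) ⊆ (shift 𝒜)^[k'] ⁻¹' Bad := by
      intro ρ hρ
      simp only [mem_iUnion, Finset.mem_range] at hρ
      obtain ⟨j, hj, hρj⟩ := hρ
      change (shift 𝒜)^[j] ρ ∈ agreeSet τ (4 * k) at hρj
      set x := (shift 𝒜)^[j] ρ with hx
      have hxω : x ∈ agreeSet ω (2 * k) := by
        intro i h1 h2
        rw [hρj i h1 (by push_cast at *; omega), hτω i h1 h2]
      have hρx : (shift 𝒜)^[k'] ρ = (shift 𝒜)^[k' - j] x := by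
        rw [hx, ← Function.iterate_add_apply]
        congr 2
        omega
      have hvis : visits V k' ((shift 𝒜)^[k'] ρ) ≤ visits V (2 * k') ω := by
        calc visits V k' ((shift 𝒜)^[k'] ρ) = visits V k' ((shift 𝒜)^[k' - j] ω) := by
              rw [hρx]
              refine visits_congr fun i hi => ?_
              rw [← Function.iterate_add_apply _ i (k' - j) x,
                ← Function.iterate_add_apply _ i (k' - j) ω]
              exact iterate_mem_agreeSet_congr (M := M) (a := i + (k' - j)) hxω (by omega)
          _ ≤ visits V (k' - j + k') ω := by rw [visits_add]; exact Nat.le_add_left _ _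
          _ ≤ visits V (2 * k') ω := visits_mono V (by omega) ω
      change p / 2 ≤ |_|
      rw [← cast_visits]
      have h2 : (k' : ℝ)⁻¹ * visits V k' ((shift 𝒜)^[k'] ρ) < p / 2 := by
        have : (visits V k' ((shift 𝒜)^[k'] ρ) : ℝ) ≤ visits V (2 * k') ω := by
          exact_mod_cast hvis
        rw [inv_mul_lt_iff₀ hk'R]
        linarith
      rw [le_abs]
      right
      linarith
    have hE (j : ℕ) : ν.real (E j) = ν.real (agreeSet τ (4 * k)) := by
      simp only [Measure.real, E]
      rw [(herg.toMeasurePreserving.iterate j).measure_preimage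
        (hmeas τ hτ _).nullMeasurableSet]
    have hdisj : Set.Pairwise ↑(Finset.range k') (Function.onFun (AEDisjoint ν) E) := by
      have haux : ∀ a b : ℕ, a < b → b < k' → AEDisjoint ν (E a) (E b) := by
        intro a b hab hb
        refine measure_mono_null ?_ hν
        rintro ρ ⟨ha', hb'⟩ hρ
        refine hsep _ (hΩ.iterate_mem hρ a) (b - a) (by omega) (by omega) ha' ?_
        rw [← Function.iterate_add_apply, Nat.sub_add_cancel hab.le]
        exact hb'
      intro a ha b hb hab
      simp only [Finset.coe_range, mem_Iio] at ha hb
      rcases lt_or_gt_of_ne hab with hlt | hlt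
      · exact haux a b hlt hb
      · exact (haux b a hlt ha).symm
    have hmE (j : ℕ) : NullMeasurableSet (E j) ν :=
      (((herg.toMeasurePreserving.iterate j).measurable) (hmeas τ hτ _)).nullMeasurableSet
    have hsum : ν (⋃ j ∈ Finset.range k', E j) = ∑ j ∈ Finset.range k', ν (E j) :=
      measure_biUnion_finset₀ hdisj fun j _ => hmE j
    have hlt : ν (⋃ j ∈ Finset.range k', E j) < ENNReal.ofReal (C / 8) :=
      (measure_mono hsubset).trans_lt
        (((herg.toMeasurePreserving.iterate k').measure_preimage_le Bad).trans_lt hBad)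
    have hlt' : k' * ν.real (agreeSet τ (4 * k)) < C / 8 := by
      have h1 : (ν (⋃ j ∈ Finset.range k', E j)).toReal < C / 8 :=
        (ENNReal.lt_ofReal_iff_toReal_lt (measure_ne_top _ _)).1 hlt
      rw [hsum, ENNReal.toReal_sum fun _ _ => measure_ne_top _ _] at h1
      have h2 : ∑ j ∈ Finset.range k', (ν (E j)).toReal =
          k' * ν.real (agreeSet τ (4 * k)) := by
        refine (Finset.sum_congr rfl fun j _ => hE j).trans ?_
        simp
      linarith
    have hge : C ≤ l n' * ν.real (agreeSet τ (4 * k)) :=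
      (hfreq n' τ hτ).trans (mul_le_mul_of_nonneg_left
        (measureReal_mono (agreeSet_anti τ (by omega))) (Nat.cast_nonneg _))
    have h8 : (l n' : ℝ) ≤ 8 * k' := by exact_mod_cast (show l n' ≤ 8 * k' by omega)
    have := mul_le_mul_of_nonneg_right h8 (measureReal_nonneg (μ := ν) (s := agreeSet τ (4 * k)))
    linarith
  have hmul (q : ℕ) : ∀ ω ∈ Ω, q * (p * k') ≤ 2 * visits V (q * (2 * k')) ω := by
    induction q with
    | zero => intro ω _; simp
    | succ q ih =>
      intro ω hω
      have h1 := key _ (hΩ.iterate_mem hω (q * (2 * k')))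
      have h2 := ih ω hω
      rw [Nat.succ_mul, visits_add]
      push_cast
      linarith
  refine ⟨2 * k', fun ω hω L hL => ?_⟩
  set q := L / (2 * k') with hq
  have hq1 : 1 ≤ q := (Nat.one_le_div_iff (by omega)).2 hL
  have hqL : q * (2 * k') ≤ L := Nat.div_mul_le_self _ _
  have hLq : L ≤ 2 * (q * (2 * k')) := by
    have := Nat.div_add_mod L (2 * k')
    have := Nat.mod_lt L (show 0 < 2 * k' by omega)
    rw [← hq] at *
    nlinarith
  have h1 : q * (p * k') ≤ 2 * (visits V L ω : ℝ) :=
    (hmul q ω hω).trans (by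
      have := visits_mono V hqL ω
      have : (visits V (q * (2 * k')) ω : ℝ) ≤ visits V L ω := by exact_mod_cast this
      linarith)
  have h2 : (L : ℝ) ≤ 2 * (q * (2 * k')) := by exact_mod_cast hLq
  have h3 : p * L ≤ 8 * (visits V L ω : ℝ) := by
    have := mul_le_mul_of_nonneg_left h2 hp0.le
    linarith
  calc C * L ≤ M * p * L := mul_le_mul_of_nonneg_right hCp (Nat.cast_nonneg _)
    _ = M * (p * L) := by ring
    _ ≤ M * (8 * (visits V L ω : ℝ)) := mul_le_mul_of_nonneg_left h3 (Nat.cast_nonneg _)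
    _ = 8 * M * visits V L ω := by ring

end Frequency

section Norm

theorem matNorm_sq (M : Matrix (Fin 2) (Fin 2) ℝ) :
    matNorm M ^ 2 = M 0 0 ^ 2 + M 0 1 ^ 2 + M 1 0 ^ 2 + M 1 1 ^ 2 := by
  unfold matNorm
  rw [Real.sq_sqrt (by positivity)]
  simp only [Fin.sum_univ_two]
  ring

theorem matNorm_nonneg (M : Matrix (Fin 2) (Fin 2) ℝ) : 0 ≤ matNorm M := Real.sqrt_nonneg _

theorem matNorm_mul_le (X Y : Matrix (Fin 2) (Fin 2) ℝ) :
    matNorm (X * Y) ≤ matNorm X * matNorm Y := by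
  refine abs_le_of_sq_le_sq' ?_ (mul_nonneg (matNorm_nonneg _) (matNorm_nonneg _)) |>.2
  rw [mul_pow, matNorm_sq, matNorm_sq, matNorm_sq]
  simp only [Matrix.mul_apply, Fin.sum_univ_two]
  nlinarith [sq_nonneg (X 0 0 * Y 1 0 - X 0 1 * Y 0 0), sq_nonneg (X 0 0 * Y 1 1 - X 0 1 * Y 0 1),
    sq_nonneg (X 1 0 * Y 1 0 - X 1 1 * Y 0 0), sq_nonneg (X 1 0 * Y 1 1 - X 1 1 * Y 0 1)]

theorem one_le_matNorm (M : SL2) : 1 ≤ matNorm (M : Matrix (Fin 2) (Fin 2) ℝ) := by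
  refine abs_le_of_sq_le_sq' ?_ (matNorm_nonneg _) |>.2
  rw [matNorm_sq]
  have := M.det_coe
  rw [Matrix.det_fin_two] at this
  nlinarith [sq_nonneg (M.1 0 0 - M.1 1 1), sq_nonneg (M.1 0 1 + M.1 1 0)]

theorem matNorm_inv (M : SL2) :
    matNorm ((M⁻¹ : SL2) : Matrix (Fin 2) (Fin 2) ℝ) = matNorm (M : Matrix (Fin 2) (Fin 2) ℝ) := by
  refine (sq_eq_sq₀ (matNorm_nonneg _) (matNorm_nonneg _)).1 ?_
  rw [matNorm_sq, matNorm_sq, Matrix.SpecialLinearGroup.coe_inv, Matrix.adjugate_fin_two]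
  simp
  ring

/-- The key estimate behind the avalanche principle for `2 × 2` matrices. -/
theorem matNorm_mul_mul_le (a b P : Matrix (Fin 2) (Fin 2) ℝ) (ha : a.det = 1) :
    matNorm (b * a) * matNorm (a * P) ≤
      matNorm (b * a * P) * matNorm a + matNorm b * matNorm P := by
  let s : Fin 2 × Fin 2 × Fin 2 × Fin 2 → ℝ := fun x =>
    (b * a * P) x.1 x.2.2.2 * a x.2.2.1 x.2.1
  let t : Fin 2 × Fin 2 × Fin 2 × Fin 2 → ℝ := fun x =>
    (b * a) x.1 x.2.1 * (a * P) x.2.2.1 x.2.2.2 - s x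
  have hs : ∑ x, s x ^ 2 = (matNorm (b * a * P) * matNorm a) ^ 2 := by
    rw [mul_pow, matNorm_sq, matNorm_sq]
    simp only [s, Fintype.sum_prod_type, Fin.sum_univ_two]
    ring
  have ht' (x) : t x ^ 2 = (b x.1 (1 - x.2.2.1) * P (1 - x.2.1) x.2.2.2) ^ 2 := by
    obtain ⟨i, j, k, l⟩ := x
    have h : t (i, j, k, l) = a.det * (b i (1 - k) * P (1 - j) l) ∨
        t (i, j, k, l) = -(a.det * (b i (1 - k) * P (1 - j) l)) := by
      simp only [t, s, Matrix.mul_apply, Fin.sum_univ_two, Matrix.det_fin_two]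
      fin_cases j <;> fin_cases k <;> simp
      · right; ring
      · left; ring
      · left; ring
      · right; ring
    rw [ha, one_mul] at h
    rcases h with h | h <;> rw [h]
    rw [neg_sq]
  have ht : ∑ x, t x ^ 2 = (matNorm b * matNorm P) ^ 2 := by
    rw [mul_pow, matNorm_sq, matNorm_sq, Finset.sum_congr rfl fun x _ => ht' x]
    simp [Fintype.sum_prod_type, Fin.sum_univ_two]
    ring
  have hst : ∑ x, (s x + t x) ^ 2 = (matNorm (b * a) * matNorm (a * P)) ^ 2 := by
    rw [mul_pow, matNorm_sq, matNorm_sq]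
    simp only [t, add_sub_cancel, Fintype.sum_prod_type, Fin.sum_univ_two]
    ring
  have hcs : ∑ x, s x * t x ≤ matNorm (b * a * P) * matNorm a * (matNorm b * matNorm P) := by
    refine abs_le_of_sq_le_sq' ?_ (by simp only [mul_nonneg, matNorm_nonneg]) |>.2
    rw [mul_pow, ← hs, ← ht]
    exact Finset.sum_mul_sq_le_sq_mul_sq _ _ _
  refine abs_le_of_sq_le_sq' ?_ (by simp only [add_nonneg, mul_nonneg, matNorm_nonneg]) |>.2
  have hexp : ∑ x, (s x + t x) ^ 2 = ∑ x, s x ^ 2 + 2 * ∑ x, s x * t x + ∑ x, t x ^ 2 := by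
    simp only [add_sq, Finset.sum_add_distrib, mul_assoc, ← Finset.mul_sum]
  rw [← hst, hexp, add_sq, ← hs, ← ht]
  linarith

end Norm

section Cocycle

variable {𝒜 : Type*}

theorem cocycle_add {G : Type*} [Monoid G] (A : (ℤ → 𝒜) → G) (a b : ℕ) (ω : ℤ → 𝒜) :
    cocycle A (a + b) ω = cocycle A b ((shift 𝒜)^[a] ω) * cocycle A a ω := by
  induction b with
  | zero => simp [cocycle]
  | succ b ih =>
    rw [← add_assoc, cocycle, cocycle, ih, mul_assoc, ← Function.iterate_add_apply, add_comm b a]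

theorem cocycle_congr {G : Type*} [Monoid G] [TopologicalSpace 𝒜] {Ω : Set (ℤ → 𝒜)}
    (hΩ : IsSubshift Ω) {A : (ℤ → 𝒜) → G} {P : ℕ}
    (hloc : ∀ ω ∈ Ω, ∀ ρ ∈ Ω, ρ ∈ agreeSet ω P → A ρ = A ω) {ω ρ : ℤ → 𝒜} (hω : ω ∈ Ω)
    (hρ : ρ ∈ Ω) {n K : ℕ} (hn : n + P ≤ K) (h : ρ ∈ agreeSet ω K) :
    cocycle A n ρ = cocycle A n ω := by
  induction n with
  | zero => rfl
  | succ n ih =>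
    rw [cocycle, cocycle, ih (by omega)]
    congr 1
    refine hloc _ (hΩ.iterate_mem hω n) _ (hΩ.iterate_mem hρ n) fun i h1 h2 => ?_
    rw [shift_iterate_apply, shift_iterate_apply]
    exact h _ (by omega) (by zify at hn; omega)

/-- The logarithm of the norm of the cocycle over `A`. -/
noncomputable def logNorm (A : (ℤ → 𝒜) → SL2) (n : ℕ) (ω : ℤ → 𝒜) : ℝ :=
  Real.log (matNorm ((cocycle A n ω : SL2) : Matrix (Fin 2) (Fin 2) ℝ))

variable (A : (ℤ → 𝒜) → SL2)

theorem logNorm_nonneg (n : ℕ) (ω : ℤ → 𝒜) : 0 ≤ logNorm A n ω :=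
  Real.log_nonneg (one_le_matNorm _)

theorem log_matNorm_mul_le (X Y : SL2) :
    Real.log (matNorm ((X * Y : SL2) : Matrix (Fin 2) (Fin 2) ℝ)) ≤
      Real.log (matNorm (X : Matrix (Fin 2) (Fin 2) ℝ)) +
        Real.log (matNorm (Y : Matrix (Fin 2) (Fin 2) ℝ)) := by
  have hX := one_le_matNorm X
  have hY := one_le_matNorm Y
  rw [← Real.log_mul (by linarith) (by linarith)]
  refine Real.log_le_log (zero_lt_one.trans_le (one_le_matNorm _)) ?_
  rw [Matrix.SpecialLinearGroup.coe_mul]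
  exact matNorm_mul_le _ _

theorem logNorm_add_le (a b : ℕ) (ω : ℤ → 𝒜) :
    logNorm A (a + b) ω ≤ logNorm A a ω + logNorm A b ((shift 𝒜)^[a] ω) := by
  unfold logNorm
  rw [cocycle_add, add_comm (Real.log _)]
  exact log_matNorm_mul_le _ _

theorem logNorm_le_left (a b : ℕ) (ω : ℤ → 𝒜) :
    logNorm A a ω ≤ logNorm A (a + b) ω + logNorm A b ((shift 𝒜)^[a] ω) := by
  unfold logNorm
  have h := log_matNorm_mul_le (cocycle A b ((shift 𝒜)^[a] ω))⁻¹ (cocycle A (a + b) ω)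
  rw [matNorm_inv, cocycle_add, inv_mul_cancel_left] at h
  rw [cocycle_add]
  linarith

theorem logNorm_le_right (a b : ℕ) (ω : ℤ → 𝒜) :
    logNorm A b ((shift 𝒜)^[a] ω) ≤ logNorm A (a + b) ω + logNorm A a ω := by
  unfold logNorm
  have h := log_matNorm_mul_le (cocycle A (a + b) ω) (cocycle A a ω)⁻¹
  rw [matNorm_inv, cocycle_add, mul_inv_cancel_right] at h
  rw [cocycle_add]
  linarith

variable {A}

theorem logNorm_le_mul [TopologicalSpace 𝒜] {Ω : Set (ℤ → 𝒜)} (hΩ : IsSubshift Ω) {b : ℝ}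
    (hb : ∀ ω ∈ Ω, logNorm A 1 ω ≤ b) (hb0 : Real.log (matNorm 1) ≤ b) (n : ℕ) :
    ∀ ω ∈ Ω, logNorm A n ω ≤ (n + 1) * b := by
  induction n with
  | zero =>
    intro ω _
    simpa [logNorm, cocycle] using hb0
  | succ n ih =>
    intro ω hω
    have h1 := logNorm_add_le A n 1 ω
    have h2 := hb _ (hΩ.iterate_mem hω n)
    have h3 := ih ω hω
    push_cast
    linarith

/-- The uniform exponential growth rate of a bounded cocycle. -/
theorem exists_growth_rate [TopologicalSpace 𝒜] {Ω : Set (ℤ → 𝒜)} (hΩ : IsSubshift Ω)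
    (hne : Ω.Nonempty) {b : ℝ} (hb : ∀ ω ∈ Ω, logNorm A 1 ω ≤ b)
    (hb0 : Real.log (matNorm 1) ≤ b) :
    ∃ Λ : ℝ, 0 ≤ Λ ∧ (∀ n : ℕ, ∃ ω ∈ Ω, Λ * n - 1 ≤ logNorm A n ω) ∧
      ∀ δ > 0, ∃ B ≥ 0, ∀ ω ∈ Ω, ∀ n : ℕ, logNorm A n ω ≤ (Λ + δ) * n + B := by
  let u : ℕ → ℝ := fun n => sSup (logNorm A n '' Ω)
  have hbdd (n : ℕ) : BddAbove (logNorm A n '' Ω) :=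
    ⟨(n + 1) * b, by rintro _ ⟨ω, hω, rfl⟩; exact logNorm_le_mul hΩ hb hb0 n ω hω⟩
  have hle (n : ℕ) {ω : ℤ → 𝒜} (hω : ω ∈ Ω) : logNorm A n ω ≤ u n :=
    le_csSup (hbdd n) (mem_image_of_mem _ hω)
  obtain ⟨ω₀, hω₀⟩ := hne
  have hu0 (n : ℕ) : 0 ≤ u n := (logNorm_nonneg A n ω₀).trans (hle n hω₀)
  have hsub : Subadditive u := by
    intro p q
    refine csSup_le ⟨_, mem_image_of_mem _ hω₀⟩ ?_
    rintro _ ⟨ω, hω, rfl⟩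
    exact (logNorm_add_le A p q ω).trans (add_le_add (hle p hω) (hle q (hΩ.iterate_mem hω p)))
  have hbelow : BddBelow (range fun n => u n / n) :=
    ⟨0, by rintro _ ⟨n, rfl⟩; exact div_nonneg (hu0 n) (Nat.cast_nonneg n)⟩
  have hlim := hsub.tendsto_lim hbelow
  have hΛ0 : 0 ≤ hsub.lim :=
    ge_of_tendsto' hlim fun n => div_nonneg (hu0 n) (Nat.cast_nonneg n)
  refine ⟨hsub.lim, hΛ0, fun n => ?_, fun δ hδ => ?_⟩
  · have h1 : hsub.lim * n ≤ u n := by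
      rcases Nat.eq_zero_or_pos n with rfl | hn
      · simpa using hu0 0
      · have hn' : (0 : ℝ) < n := by exact_mod_cast hn
        exact (le_div_iff₀ hn').1 (hsub.lim_le_div hbelow hn.ne')
    obtain ⟨_, ⟨ω, hω, rfl⟩, h⟩ := exists_lt_of_lt_csSup
      (show (logNorm A n '' Ω).Nonempty from ⟨_, mem_image_of_mem _ hω₀⟩) (sub_one_lt (u n))
    exact ⟨ω, hω, by linarith⟩
  · obtain ⟨n₀, hn₀⟩ := eventually_atTop.1
      (hlim.eventually_lt_const (show hsub.lim < hsub.lim + δ by linarith))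
    have hb' : 0 ≤ b := (logNorm_nonneg A 1 ω₀).trans (hb ω₀ hω₀)
    refine ⟨(n₀ + 1) * b, by positivity, fun ω hω n => ?_⟩
    rcases le_or_gt n₀ n with hn | hn
    · rcases Nat.eq_zero_or_pos n with rfl | hpos
      · have := logNorm_le_mul hΩ hb hb0 0 ω hω
        have : (0 : ℝ) ≤ n₀ * b := by positivity
        simp at *
        linarith
      · have hn' : (0 : ℝ) < n := by exact_mod_cast hpos
        have h1 := (div_lt_iff₀ hn').1 (hn₀ n hn)
        have h2 := hle n hω
        have : 0 ≤ (n₀ + 1) * b := by positivity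
        linarith
    · have h1 := logNorm_le_mul hΩ hb hb0 n ω hω
      have h2 : (n : ℝ) ≤ n₀ := by exact_mod_cast hn.le
      have h3 : 0 ≤ (hsub.lim + δ) * n := by positivity
      nlinarith

/-- Multiplicative lower bound from two-block growth (avalanche principle). -/
theorem pow_le_matNorm_cocycle {m : ℕ} {ω : ℤ → 𝒜} {y z : ℝ} (hy0 : 0 < y) (hyz : 2 * y ≤ z)
    (hy : ∀ j : ℕ, matNorm (cocycle A m ((shift 𝒜)^[j] ω) : SL2).1 ≤ y)
    (hz : ∀ j : ℕ, z ≤ matNorm (cocycle A (2 * m) ((shift 𝒜)^[j] ω) : SL2).1) (n : ℕ) :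
    (z / (2 * y)) ^ n ≤ matNorm (cocycle A (n * m) ω : SL2).1 := by
  set c := z / (2 * y) with hc
  have hc1 : 1 ≤ c := (one_le_div (by positivity)).2 hyz
  have hzc : z = 2 * y * c := by rw [hc]; field_simp
  have hstep (n : ℕ) : c * matNorm (cocycle A (n * m) ω : SL2).1 ≤
      matNorm (cocycle A ((n + 1) * m) ω : SL2).1 := by
    induction n with
    | zero =>
      have h1 := hz 0
      have h2 := hy m
      have h3 := hy 0
      have h4 : matNorm (1 : Matrix (Fin 2) (Fin 2) ℝ) ≤ 2 := by
        refine abs_le_of_sq_le_sq' ?_ zero_le_two |>.2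
        rw [matNorm_sq]
        norm_num
      simp only [Function.iterate_zero, id, two_mul, cocycle_add,
        Matrix.SpecialLinearGroup.coe_mul] at h1 h3
      have h5 := matNorm_mul_le (cocycle A m ((shift 𝒜)^[m] ω) : SL2).1 (cocycle A m ω : SL2).1
      have h6 := mul_le_mul_of_nonneg_right h2 (matNorm_nonneg (cocycle A m ω : SL2).1)
      have h7 : 2 * c ≤ matNorm (cocycle A m ω : SL2).1 := by
        refine le_of_mul_le_mul_left ?_ hy0
        linarith
      simp only [zero_mul, cocycle, zero_add, one_mul, Matrix.SpecialLinearGroup.coe_one]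
      nlinarith
    | succ n ih =>
      set a := cocycle A m ((shift 𝒜)^[n * m] ω) with ha
      set b := cocycle A m ((shift 𝒜)^[(n + 1) * m] ω) with hb
      set P := cocycle A (n * m) ω with hP
      have e1 : cocycle A ((n + 1) * m) ω = a * P := by rw [Nat.succ_mul, cocycle_add]
      have e2 : cocycle A ((n + 1 + 1) * m) ω = b * a * P := by
        rw [Nat.succ_mul, cocycle_add, e1, mul_assoc]
      have e3 : cocycle A (2 * m) ((shift 𝒜)^[n * m] ω) = b * a := by
        rw [two_mul, cocycle_add, ← Function.iterate_add_apply, add_comm m, ← Nat.succ_mul]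
      have hba := hz (n * m)
      have ha1 := hy (n * m)
      have hb1 := hy ((n + 1) * m)
      rw [e3] at hba
      rw [e1] at ih ⊢
      rw [e2]
      simp only [Matrix.SpecialLinearGroup.coe_mul] at *
      have key := matNorm_mul_mul_le a.1 b.1 P.1 a.2
      have hP1 := one_le_matNorm P
      have k1 := mul_le_mul_of_nonneg_right hba (matNorm_nonneg (a.1 * P.1))
      have k2 := mul_le_mul_of_nonneg_left ha1 (matNorm_nonneg (b.1 * a.1 * P.1))
      have k3 := mul_le_mul_of_nonneg_right hb1 (matNorm_nonneg P.1)
      have k4 : matNorm P.1 ≤ c * matNorm (a.1 * P.1) := by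
        have : matNorm P.1 ≤ matNorm (a.1 * P.1) := by nlinarith
        nlinarith [matNorm_nonneg (a.1 * P.1)]
      have k5 := mul_le_mul_of_nonneg_left k4 hy0.le
      refine le_of_mul_le_mul_left ?_ hy0
      rw [hzc] at k1
      have : matNorm (b.1 * a.1) * matNorm (a.1 * P.1) ≤ matNorm (b.1 * a.1 * P.1) * y
        + y * matNorm P.1 := by linarith
      linarith
  induction n with
  | zero => simpa [cocycle] using one_le_matNorm (1 : SL2)
  | succ n ih =>
    rw [pow_succ']
    exact (mul_le_mul_of_nonneg_left ih (by linarith)).trans (hstep n)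

theorem exists_logNorm_ge [TopologicalSpace 𝒜] {Ω : Set (ℤ → 𝒜)} (hΩ : IsSubshift Ω) {Λ : ℝ}
    (hΛ : 0 < Λ)
    (hup : ∀ δ > 0, ∃ B ≥ 0, ∀ ω ∈ Ω, ∀ n : ℕ, logNorm A n ω ≤ (Λ + δ) * n + B)
    (hblock : ∀ ε > 0, ∀ K : ℕ, ∃ m ≥ K, ∀ ω ∈ Ω, (Λ - ε) * (2 * m) ≤ logNorm A (2 * m) ω)
    {ε : ℝ} (hε : 0 < ε) :
    ∃ n₀ : ℕ, ∀ n ≥ n₀, ∀ ω ∈ Ω, (Λ - ε) * n ≤ logNorm A n ω := by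
  set e := min ε Λ / 8 with he
  have he0 : 0 < e := by positivity
  have heε : 8 * e ≤ ε := by rw [he]; linarith [min_le_left ε Λ]
  have heΛ : 8 * e ≤ Λ := by rw [he]; linarith [min_le_right ε Λ]
  obtain ⟨B, hB0, hB⟩ := hup e he0
  obtain ⟨K, hK⟩ := exists_nat_ge ((B + 1) / e)
  obtain ⟨m, hmK, hm⟩ := hblock e he0 K
  have hmB : B + 1 ≤ e * m := by
    have : (K : ℝ) ≤ m := by exact_mod_cast hmK
    rw [mul_comm]
    exact (div_le_iff₀ he0).1 (hK.trans this)
  have hm0 : 0 < m := by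
    rcases Nat.eq_zero_or_pos m with rfl | h
    · simp at hmB; linarith
    · exact h
  have hlog2 : Real.log 2 ≤ 1 := by linarith [Real.log_two_lt_d9]
  have h2 : (2 : ℝ) ≤ Real.exp (e * m) := by
    rw [← Real.log_le_iff_le_exp two_pos]
    linarith
  have hmR : (0 : ℝ) < m := by exact_mod_cast hm0
  have hlow (q : ℕ) : ∀ ω ∈ Ω, q * ((Λ - 5 * e) * m) ≤ logNorm A (q * m) ω := by
    intro ω hω
    have := pow_le_matNorm_cocycle (A := A) (m := m) (ω := ω) (y := Real.exp ((Λ + 2 * e) * m))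
      (z := Real.exp (2 * (Λ - e) * m)) (Real.exp_pos _) ?_ ?_ ?_ q
    · refine (Real.le_log_iff_exp_le (zero_lt_one.trans_le (one_le_matNorm _))).2 (le_trans ?_ this)
      rw [Real.exp_nat_mul]
      refine pow_le_pow_left₀ (Real.exp_pos _).le ?_ q
      rw [le_div_iff₀ (by positivity)]
      calc Real.exp ((Λ - 5 * e) * m) * (2 * Real.exp ((Λ + 2 * e) * m))
          ≤ Real.exp ((Λ - 5 * e) * m) * (Real.exp (e * m) * Real.exp ((Λ + 2 * e) * m)) := by
            gcongr
        _ = Real.exp (2 * (Λ - e) * m) := by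
            rw [← Real.exp_add, ← Real.exp_add]
            ring_nf
    · calc 2 * Real.exp ((Λ + 2 * e) * m) ≤ Real.exp (e * m) * Real.exp ((Λ + 2 * e) * m) := by
            gcongr
        _ = Real.exp ((Λ + 3 * e) * m) := by
            rw [← Real.exp_add]
            ring_nf
        _ ≤ Real.exp (2 * (Λ - e) * m) := by
            gcongr
            linarith
    · intro j
      rw [← Real.log_le_iff_le_exp (zero_lt_one.trans_le (one_le_matNorm _))]
      refine (hB _ (hΩ.iterate_mem hω j) m).trans ?_
      linarith
    · intro j
      rw [← Real.le_log_iff_exp_le (zero_lt_one.trans_le (one_le_matNorm _))]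
      refine le_trans (le_of_eq ?_) (hm _ (hΩ.iterate_mem hω j))
      ring
  obtain ⟨n₀, hn₀⟩ := exists_nat_ge ((2 * (Λ + e) * m + B) / e)
  refine ⟨n₀, fun n hn ω hω => ?_⟩
  have hD : 2 * (Λ + e) * m + B ≤ e * n := by
    have : (n₀ : ℝ) ≤ n := by exact_mod_cast hn
    rw [mul_comm e]
    exact (div_le_iff₀ he0).1 (hn₀.trans this)
  have hdecomp : n / m * m + n % m = n := Nat.div_add_mod' n m
  have h1 := hlow (n / m) ω hω
  have h3 := logNorm_le_left A (n / m * m) (n % m) ω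
  have h4 := hB _ (hΩ.iterate_mem hω (n / m * m)) (n % m)
  rw [hdecomp] at h3
  have hsm : ((n % m : ℕ) : ℝ) ≤ m := by exact_mod_cast (Nat.mod_lt n hm0).le
  have hcast : ((n / m : ℕ) : ℝ) * m + (n % m : ℕ) = n := by exact_mod_cast hdecomp
  have h5 : ((n / m : ℕ) : ℝ) * ((Λ - 5 * e) * m) = (Λ - 5 * e) * (n - (n % m : ℕ)) := by
    rw [← hcast]
    ring
  rw [h5] at h1
  have h6 : (Λ + e) * ((n % m : ℕ) : ℝ) ≤ (Λ + e) * m := by gcongr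
  have h7 : (Λ - 5 * e) * ((n % m : ℕ) : ℝ) ≤ (Λ + e) * m := by
    have : 0 ≤ ((n % m : ℕ) : ℝ) := Nat.cast_nonneg _
    nlinarith
  have hn0 : (0 : ℝ) ≤ n := Nat.cast_nonneg _
  nlinarith

end Cocycle

section Block

variable {𝒜 : Type*}

theorem visits_le_one [TopologicalSpace 𝒜] {Ω : Set (ℤ → 𝒜)} (hΩ : IsSubshift Ω)
    {V : Set (ℤ → 𝒜)} {m : ℕ}
    (hsep : ∀ ρ ∈ Ω, ∀ s : ℕ, 1 ≤ s → s < m → ρ ∈ V → (shift 𝒜)^[s] ρ ∉ V)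
    {n : ℕ} (hn : n ≤ m) {ρ : ℤ → 𝒜} (hρ : ρ ∈ Ω) : visits V n ρ ≤ 1 := by
  classical
  have haux : ∀ a b : ℕ, a < b → b < n → (shift 𝒜)^[a] ρ ∈ V → (shift 𝒜)^[b] ρ ∉ V := by
    intro a b hab hb ha
    have := hsep _ (hΩ.iterate_mem hρ a) (b - a) (by omega) (by omega) ha
    rwa [← Function.iterate_add_apply, Nat.sub_add_cancel hab.le] at this
  unfold visits
  rw [Finset.sum_boole, Nat.cast_id, Finset.card_le_one]
  intro a ha b hb
  simp only [Finset.mem_filter, Finset.mem_range] at ha hb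
  by_contra hab
  rcases lt_or_gt_of_ne hab with h | h
  · exact haux a b h hb.1 ha.2 hb.2
  · exact haux b a h ha.1 hb.2 ha.2

/-- Each visit to a separated set `V` on which the cocycle grows slowly improves the upper bound. -/
theorem logNorm_le_sub_visits [TopologicalSpace 𝒜] {Ω : Set (ℤ → 𝒜)} (hΩ : IsSubshift Ω)
    {A : (ℤ → 𝒜) → SL2} {V : Set (ℤ → 𝒜)} {m : ℕ} (hm : 1 ≤ m)
    (hsep : ∀ ρ ∈ Ω, ∀ s : ℕ, 1 ≤ s → s < m → ρ ∈ V → (shift 𝒜)^[s] ρ ∉ V)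
    {Γ B κ : ℝ} (hκ : 0 ≤ κ) (hup : ∀ ω ∈ Ω, ∀ n : ℕ, logNorm A n ω ≤ Γ * n + B)
    (hV : ∀ ρ ∈ Ω, ρ ∈ V → logNorm A m ρ + B + κ ≤ Γ * m) (L : ℕ) :
    ∀ ρ ∈ Ω, logNorm A L ρ ≤ Γ * L + B + κ - κ * visits V L ρ := by
  classical
  induction L using Nat.strong_induction_on with
  | _ L ih =>
    intro ρ hρ
    by_cases hex : ∃ i : ℕ, i + m ≤ L ∧ (shift 𝒜)^[i] ρ ∈ V
    · obtain ⟨i, hiL, hiV, hmin⟩ : ∃ i : ℕ, i + m ≤ L ∧ (shift 𝒜)^[i] ρ ∈ V ∧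
          ∀ j < i, (shift 𝒜)^[j] ρ ∉ V := by
        obtain ⟨h1, h2⟩ := Nat.find_spec hex
        exact ⟨_, h1, h2, fun j hj hjV => Nat.find_min hex hj ⟨by omega, hjV⟩⟩
      obtain ⟨L', rfl⟩ := Nat.exists_eq_add_of_le hiL
      have hz : visits V i ρ = 0 := visits_eq_zero hmin
      have hρi := hΩ.iterate_mem hρ i
      have h1 := visits_le_one hΩ hsep le_rfl hρi
      have h2 := ih L' (by omega) _ (hΩ.iterate_mem hρ (i + m))
      have h3 := logNorm_add_le A (i + m) L' ρ
      have h4 := logNorm_add_le A i m ρ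
      have h5 := hV _ hρi hiV
      have h6 := hup ρ hρ i
      rw [visits_add, visits_add, hz]
      have h1' : (visits V m ((shift 𝒜)^[i] ρ) : ℝ) ≤ 1 := by exact_mod_cast h1
      have h7 := mul_le_mul_of_nonneg_left h1' hκ
      push_cast
      linarith
    · push Not at hex
      have hv : visits V L ρ ≤ 1 := by
        have hsplit : L - m + (L - (L - m)) = L := by omega
        rw [← hsplit, visits_add, visits_eq_zero fun j hj => hex j (by omega), zero_add]
        exact visits_le_one hΩ hsep (by omega) (hΩ.iterate_mem hρ _)
      have hv' : (visits V L ρ : ℝ) ≤ 1 := by exact_mod_cast hv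
      have h7 := mul_le_mul_of_nonneg_left hv' hκ
      have := hup ρ hρ L
      linarith

theorem exists_block_logNorm_ge [TopologicalSpace 𝒜] {Ω : Set (ℤ → 𝒜)} (hΩ : IsSubshift Ω)
    (hap : ∀ ρ ∈ Ω, ∀ r : ℕ, 1 ≤ r → ∃ q : ℕ, 1 ≤ q ∧ ρ (q + r) ≠ ρ q)
    {A : (ℤ → 𝒜) → SL2} {P : ℕ} (hloc : ∀ ω ∈ Ω, ∀ ρ ∈ Ω, ρ ∈ agreeSet ω P → A ρ = A ω)
    {Λ : ℝ} (hlow : ∀ n : ℕ, ∃ ω ∈ Ω, Λ * n - 1 ≤ logNorm A n ω)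
    (hup : ∀ δ > 0, ∃ B ≥ 0, ∀ ω ∈ Ω, ∀ n : ℕ, logNorm A n ω ≤ (Λ + δ) * n + B)
    {C : ℝ} (hC : 0 < C) {l : ℕ → ℕ} (hl : Tendsto l atTop atTop)
    (hvis : ∀ σ ∈ Ω, ∀ n, ∃ L₀ : ℕ, ∀ ω ∈ Ω, ∀ L ≥ L₀,
      C * L ≤ 8 * l n * visits (agreeSet σ (l n)) L ω)
    {ε : ℝ} (hε : 0 < ε) (K : ℕ) :
    ∃ m ≥ K, ∀ ω ∈ Ω, (Λ - ε) * (2 * m) ≤ logNorm A (2 * m) ω := by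
  set δ := ε * C / 512 with hδ
  have hδ0 : 0 < δ := by positivity
  obtain ⟨B, hB0, hB⟩ := hup δ hδ0
  obtain ⟨K', hK'⟩ := exists_nat_ge (32 * B / ε)
  obtain ⟨n, hn⟩ := (hl.eventually_ge_atTop (16 * K + 8 * P + K' + 16)).exists
  set M := l n with hM
  refine ⟨M / 16, by omega, fun ω hω => ?_⟩
  by_contra! hcon
  set μ := 2 * (M / 16) with hμ
  have hμcast : (2 : ℝ) * ((M / 16 : ℕ) : ℝ) = (μ : ℕ) := by rw [hμ]; push_cast; rfl
  rw [hμcast] at hcon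
  obtain ⟨τ, hτ, hτω, hsep⟩ := exists_separated_extension hΩ hap hω (μ + P)
  have hμM : (M : ℝ) ≤ 16 * μ := by exact_mod_cast (show M ≤ 16 * μ by omega)
  have hBM : B ≤ ε * M / 32 := by
    have h1 : (K' : ℝ) ≤ M := by exact_mod_cast (show K' ≤ M by omega)
    have h2 := (div_le_iff₀ hε).1 (hK'.trans h1)
    linarith
  have hεμ : ε * M ≤ ε * (16 * μ) := mul_le_mul_of_nonneg_left hμM hε.le
  set V := agreeSet τ M with hV
  set κ := ε * μ / 2 with hκ
  have hκ0 : 0 ≤ κ := by positivity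
  have hBκ : B ≤ κ := by rw [hκ]; linarith
  have hsep' : ∀ ρ ∈ Ω, ∀ s : ℕ, 1 ≤ s → s < μ → ρ ∈ V → (shift 𝒜)^[s] ρ ∉ V := by
    intro ρ hρ s h1 h2 hρV hsV
    have hsub : V ⊆ agreeSet τ (4 * (μ + P)) := agreeSet_anti τ (by omega)
    exact hsep ρ hρ s h1 (by omega) (hsub hρV) (hsub hsV)
  have hVslow : ∀ ρ ∈ Ω, ρ ∈ V → logNorm A μ ρ + B + κ ≤ (Λ + δ) * μ := by
    intro ρ hρ hρV
    have hρω : ρ ∈ agreeSet ω (2 * (μ + P)) := by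
      intro i h1 h2
      rw [hρV i h1 (by push_cast at *; omega), hτω i h1 h2]
    have : logNorm A μ ρ = logNorm A μ ω := by
      unfold logNorm
      rw [cocycle_congr hΩ hloc hω hρ (by omega) hρω]
    rw [this]
    have : 0 ≤ δ * μ := by positivity
    linarith
  have hmain := logNorm_le_sub_visits hΩ (show 1 ≤ μ by omega) hsep' hκ0 hB hVslow
  obtain ⟨L₀, hL₀⟩ := hvis τ hτ n
  obtain ⟨L₁, hL₁⟩ := exists_nat_gt ((B + κ + 1) / δ)
  set L := max L₀ L₁ with hL
  obtain ⟨ρ, hρ, hρL⟩ := hlow L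
  have h1 := hmain L ρ hρ
  have h2 := hL₀ ρ hρ L (le_max_left _ _)
  have h3 : B + κ + 1 < δ * L := by
    have : (L₁ : ℝ) ≤ L := by exact_mod_cast le_max_right _ _
    rw [mul_comm]
    exact (div_lt_iff₀ hδ0).1 (hL₁.trans_le this)
  have h4 : ε * (C * L) ≤ 256 * (κ * visits V L ρ) := by
    have hv : 0 ≤ (visits V L ρ : ℝ) := Nat.cast_nonneg _
    have h5 := mul_le_mul_of_nonneg_left h2 hε.le
    have h6 := mul_le_mul_of_nonneg_right hεμ hv
    rw [hκ]
    rw [← hM, ← hV] at h5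
    linarith
  have h5 : 512 * (δ * L) = ε * (C * L) := by rw [hδ]; ring
  linarith

end Block

section Uniform

variable {𝒜 : Type*}

theorem bddAbove_image_of_agreeSet [Finite 𝒜] {Ω : Set (ℤ → 𝒜)} {f : (ℤ → 𝒜) → ℝ} {P : ℕ}
    (hf : ∀ ω ∈ Ω, ∀ ρ ∈ Ω, ρ ∈ agreeSet ω P → f ρ = f ω) : BddAbove (f '' Ω) := by
  let φ : Ω → Fin P → 𝒜 := fun ω i => ω.1 (1 + i)
  have hfac : Function.FactorsThrough (fun ω : Ω => f ω) φ := by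
    intro ρ ω h
    refine hf ω ω.2 ρ ρ.2 fun i h1 h2 => ?_
    have := congrFun h ⟨(i - 1).toNat, by omega⟩
    simp only [φ] at this
    rwa [Int.toNat_of_nonneg (by omega), add_sub_cancel] at this
  refine ((finite_range (Function.extend φ (fun ω : Ω => f ω) 0)).subset ?_).bddAbove
  rintro _ ⟨ω, hω, rfl⟩
  exact ⟨φ ⟨ω, hω⟩, hfac.extend_apply 0 ⟨ω, hω⟩⟩

/-- If all points of `Ω` reach a common point in bounded time, then the cocycle grows at the same
rate everywhere, up to a bounded error. -/
theorem exists_logNorm_le_add [TopologicalSpace 𝒜] {Ω : Set (ℤ → 𝒜)} (hΩ : IsSubshift Ω)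
    {A : (ℤ → 𝒜) → SL2} {b : ℝ} (hb : ∀ ω ∈ Ω, ∀ n : ℕ, logNorm A n ω ≤ (n + 1) * b)
    (hb0 : 0 ≤ b) {τ : ℤ → 𝒜} {r : ℕ} (hτ : ∀ ω ∈ Ω, ∃ k : ℕ, k < r ∧ (shift 𝒜)^[k] ω = τ) :
    ∃ D : ℝ, ∀ ω ∈ Ω, ∀ ρ ∈ Ω, ∀ n : ℕ, logNorm A n ρ ≤ logNorm A n ω + D := by
  have hbr : ∀ ω ∈ Ω, ∀ k : ℕ, k < r → logNorm A k ω ≤ r * b := by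
    intro ω hω k hk
    refine (hb ω hω k).trans (mul_le_mul_of_nonneg_right ?_ hb0)
    exact_mod_cast hk
  refine ⟨4 * (r * b), fun ω hω ρ hρ n => ?_⟩
  obtain ⟨i, hi, hiω⟩ := hτ ω hω
  obtain ⟨j, hj, hjρ⟩ := hτ ρ hρ
  have h1 := logNorm_le_left A n j ρ
  have h2 := logNorm_add_le A j n ρ
  have h3 := logNorm_le_right A i n ω
  have h4 := logNorm_add_le A n i ω
  have h5 := hbr _ hρ j hj
  have h6 := hbr _ (hΩ.iterate_mem hρ n) j hj
  have h7 := hbr _ hω i hi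
  have h8 := hbr _ (hΩ.iterate_mem hω n) i hi
  rw [hjρ, add_comm j n] at h2
  rw [hiω, add_comm i n] at h3
  linarith

/-- Uniformity for cocycles depending on finitely many positive coordinates. -/
theorem exists_tendstoUniformlyOn_of_agreeSet [Finite 𝒜] [TopologicalSpace 𝒜] [DiscreteTopology 𝒜]
    [MeasurableSpace 𝒜] {Ω : Set (ℤ → 𝒜)} (hmin : IsMinimalSubshift Ω) (hB : CondB Ω)
    {A : (ℤ → 𝒜) → SL2} {P : ℕ} (hloc : ∀ ω ∈ Ω, ∀ ρ ∈ Ω, ρ ∈ agreeSet ω P → A ρ = A ω) :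
    ∃ Λ : ℝ, ∀ ε > 0, ∃ n₀ : ℕ, ∀ n ≥ n₀, ∀ ω ∈ Ω, |logNorm A n ω - Λ * n| ≤ ε * n := by
  obtain ⟨ν, _, hν, herg, C, hC, l, hl, hfreq⟩ := hB
  have hΩ := hmin.1
  have hne : Ω.Nonempty := by
    rw [nonempty_iff_ne_empty]
    rintro rfl
    simp at hν
  obtain ⟨b₀, hb₀⟩ := bddAbove_image_of_agreeSet (Ω := Ω) (f := logNorm A 1) (P := 1 + P) <| by
    intro ω hω ρ hρ h
    unfold logNorm
    rw [cocycle_congr hΩ hloc hω hρ le_rfl h]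
  set b := max b₀ (Real.log (matNorm 1)) with hbdef
  have hb : ∀ ω ∈ Ω, logNorm A 1 ω ≤ b := fun ω hω =>
    (hb₀ (mem_image_of_mem _ hω)).trans (le_max_left _ _)
  have hb1 : Real.log (matNorm 1) ≤ b := le_max_right _ _
  have hb0 : 0 ≤ b := by
    obtain ⟨ω, hω⟩ := hne
    exact (logNorm_nonneg A 1 ω).trans (hb ω hω)
  obtain ⟨Λ, hΛ, hlow, hup⟩ := exists_growth_rate hΩ hne hb hb1
  have hlower : ∀ ε > 0, ∃ n₀ : ℕ, ∀ n ≥ n₀, ∀ ω ∈ Ω, (Λ - ε) * n ≤ logNorm A n ω := by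
    intro ε hε
    rcases hΛ.eq_or_lt with rfl | hΛ'
    · refine ⟨0, fun n _ ω _ => le_trans ?_ (logNorm_nonneg A n ω)⟩
      have : (0 : ℝ) ≤ ε * n := by positivity
      linarith
    by_cases hap : ∀ ρ ∈ Ω, ∀ r : ℕ, 1 ≤ r → ∃ q : ℕ, 1 ≤ q ∧ ρ (q + r) ≠ ρ q
    · refine exists_logNorm_ge hΩ hΛ' hup (fun ε hε K => ?_) hε
      have hfreq' : ∀ n, ∀ σ ∈ Ω, C ≤ l n * ν.real (agreeSet σ (l n)) := by
        intro n σ hσ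
        have := hfreq n _ (isWordOf_ofFn hσ (l n)) (by simp)
        rw [List.length_ofFn] at this
        exact this.trans (mul_le_mul_of_nonneg_left
          (measureReal_mono (Vset_ofFn_subset Ω σ (l n))) (Nat.cast_nonneg _))
      have hmeas : ∀ σ ∈ Ω, ∀ M, MeasurableSet (agreeSet σ M) := fun σ hσ M =>
        measurableSet_agreeSet (fun i => hmin.measurableSet_letter hν hσ i) M
      exact exists_block_logNorm_ge hΩ hap hloc hlow hup hC hl
        (fun σ hσ n => exists_visits_ge hΩ hap hν herg hC hl hfreq' hmeas hσ n) hε K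
    · push Not at hap
      obtain ⟨ρ, hρ, r, hr, hper⟩ := hap
      obtain ⟨τ, -, -, hτ⟩ := hmin.periodic_of_eventually hρ hr hper
      obtain ⟨D, hD⟩ := exists_logNorm_le_add hΩ
        (fun ω hω n => logNorm_le_mul hΩ hb hb1 n ω hω) hb0 hτ
      obtain ⟨n₀, hn₀⟩ := exists_nat_ge ((D + 1) / ε)
      refine ⟨n₀, fun n hn ω hω => ?_⟩
      obtain ⟨ω', hω', h⟩ := hlow n
      have h1 := hD ω hω ω' hω' n
      have h2 : (n₀ : ℝ) ≤ n := by exact_mod_cast hn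
      have h3 := (div_le_iff₀ hε).1 (hn₀.trans h2)
      linarith
  refine ⟨Λ, fun ε hε => ?_⟩
  obtain ⟨n₁, hn₁⟩ := hlower ε hε
  obtain ⟨B, -, hB⟩ := hup (ε / 2) (half_pos hε)
  obtain ⟨n₂, hn₂⟩ := exists_nat_ge (B / (ε / 2))
  refine ⟨max n₁ n₂, fun n hn ω hω => ?_⟩
  have h1 := hn₁ n (le_of_max_le_left hn) ω hω
  have h2 := hB ω hω n
  have h3 : (n₂ : ℝ) ≤ n := by exact_mod_cast le_of_max_le_right hn
  have h4 := (div_le_iff₀ (half_pos hε)).1 (hn₂.trans h3)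
  rw [abs_le]
  constructor <;> linarith

theorem cocycle_comp_iterate {G : Type*} [Monoid G] (A : (ℤ → 𝒜) → G) (k n : ℕ) (ω : ℤ → 𝒜) :
    cocycle (fun ω => A ((shift 𝒜)^[k] ω)) n ω = cocycle A n ((shift 𝒜)^[k] ω) := by
  induction n with
  | zero => rfl
  | succ n ih =>
    rw [cocycle, cocycle, ih, ← Function.iterate_add_apply, ← Function.iterate_add_apply,
      add_comm k n]

end Uniform

/-- a minimal subshift satisfying Boshernitzan's condition (B) has every
locally constant `SL(2,ℝ)`-valued cocycle uniform. -/
theorem stmt0 {𝒜 : Type*} [Fintype 𝒜] [TopologicalSpace 𝒜] [DiscreteTopology 𝒜]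
    [MeasurableSpace 𝒜] (Ω : Set (ℤ → 𝒜)) (hmin : IsMinimalSubshift Ω) (hB : CondB Ω)
    (A : (ℤ → 𝒜) → SL2) (hA : LocConstOn Ω A) :
    IsUniformOn Ω A := by 
  obtain ⟨N, hN⟩ := hA
  have hloc : ∀ ω ∈ Ω, ∀ ρ ∈ Ω, ρ ∈ agreeSet ω (2 * N + 1) →
      A ((shift 𝒜)^[N + 1] ρ) = A ((shift 𝒜)^[N + 1] ω) := by
    intro ω hω ρ hρ h
    refine hN _ (hmin.1.iterate_mem hρ _) _ (hmin.1.iterate_mem hω _) fun i hi => ?_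
    rw [abs_le] at hi
    rw [shift_iterate_apply, shift_iterate_apply]
    exact h _ (by push_cast; omega) (by push_cast; omega)
  obtain ⟨Λ, hΛ⟩ := exists_tendstoUniformlyOn_of_agreeSet hmin hB
    (A := fun ω => A ((shift 𝒜)^[N + 1] ω)) hloc
  refine ⟨Λ, Metric.tendstoUniformlyOn_iff.2 fun ε hε => ?_⟩
  obtain ⟨n₀, hn₀⟩ := hΛ (ε / 2) (half_pos hε)
  filter_upwards [eventually_ge_atTop (max n₀ 1)] with n hn ω hω
  obtain ⟨ρ, hρ, rfl⟩ := hmin.1.exists_iterate_eq hω (N + 1)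
  have h := hn₀ n (le_of_max_le_left hn) ρ hρ
  rw [logNorm, cocycle_comp_iterate] at h
  have hn0 : (0 : ℝ) < n := by exact_mod_cast le_of_max_le_right hn
  rw [dist_comm, Real.dist_eq]
  refine lt_of_le_of_lt ?_ (half_lt_self hε)
  refine le_of_mul_le_mul_right ?_ hn0
  refine le_trans (le_of_eq ?_) h
  nth_rewrite 2 [← abs_of_pos hn0]
  rw [← abs_mul, sub_mul, mul_right_comm, inv_mul_cancel₀ hn0.ne', one_mul]
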